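/- Assume q_0 has finite fourth moment. Then for every t > 0 and every x ∈ ℝ^d, the third derivative tensor of log q_t satisfies ∇_x³ log q_t(x) = λ_t³ σ_t^{−6} E_{t,x}[ (θ − m(t, x)) ⊗ (θ − m(t, x)) ⊗ (θ − m(t, x)) ], i.e. for all indices i, j, k, ∂_{x_i} ∂_{x_j} ∂_{x_k} log q_t(x) = λ_t³ σ_t^{−6} E_{t,x}[ (θ − m(t,x))_i (θ − m(t,x))_j (θ − m(t,x))_k ]. -/

import Mathlib

open MeasureTheory ProbabilityTheory Real
open scoped RealInnerProductSpace

noncomputable section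

abbrev Vec (d : ℕ) := EuclideanSpace ℝ (Fin d)

def stdGaussian (d : ℕ) : Measure (Vec d) :=
  Measure.map (⇑(EuclideanSpace.equiv (Fin d) ℝ).symm)
    (Measure.pi fun _ : Fin d => gaussianReal 0 1)

/-- The law `q_u` of `e^{-u} θ + √(1 - e^{-2u}) g`, with `θ ~ q0` and `g ~ N(0, I_d)`
independent. -/
def forwardLaw {d : ℕ} (q0 : Measure (Vec d)) (u : ℝ) : Measure (Vec d) :=
  Measure.map (fun p : Vec d × Vec d =>
      Real.exp (-u) • p.1 + Real.sqrt (1 - Real.exp (-2*u)) • p.2)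
    (q0.prod (stdGaussian d))

/-- Gaussian weight `exp(-‖x - λ_t θ‖² / (2σ_t²))`. -/
def weight {d : ℕ} (t : ℝ) (x θ : Vec d) : ℝ :=
  Real.exp (-‖x - Real.exp (-t) • θ‖^2 / (2 * (1 - Real.exp (-2*t))))

/-- The conditional law `μ_{t,x}` of `θ` given `λ_t θ + σ_t g = x`:
`dμ_{t,x}(θ) = Z_{t,x}⁻¹ exp(-‖x - λ_t θ‖²/(2σ_t²)) dq0(θ)`. -/
def condMeasure {d : ℕ} (q0 : Measure (Vec d)) (t : ℝ) (x : Vec d) : Measure (Vec d) :=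
  (∫⁻ θ, ENNReal.ofReal (weight t x θ) ∂q0)⁻¹ •
    q0.withDensity fun θ => ENNReal.ofReal (weight t x θ)

/-- The conditional mean `m(t, x) = E_{t,x}[θ]`. -/
def condMean {d : ℕ} (q0 : Measure (Vec d)) (t : ℝ) (x : Vec d) : Vec d :=
  ∫ θ, θ ∂(condMeasure q0 t x)

/-- Partial derivative in the `i`-th coordinate direction. -/
def pd {d : ℕ} (i : Fin d) (f : Vec d → ℝ) (x : Vec d) : ℝ :=
  fderiv ℝ f x (EuclideanSpace.single i 1)

lemma stdGaussian_eq_withDensity (d : ℕ) :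
    ∃ c : ℝ, 0 < c ∧ _root_.stdGaussian d =
      volume.withDensity fun z : Vec d => ENNReal.ofReal (c * Real.exp (-‖z‖ ^ 2 / 2)) := by
  have hI : Integrable (fun z : Vec d => Real.exp (-‖z‖ ^ 2 / 2)) := by
    have h := (GaussianFourier.integrable_cexp_neg_mul_sq_norm_add (V := Vec d)
      (b := 1 / 2) (by norm_num) 0 0).norm
    refine h.congr (Filter.Eventually.of_forall fun z => ?_)
    simp only [Complex.norm_exp]
    congr 1
    have hre : ((‖z‖ : ℂ) ^ 2).re = ‖z‖ ^ 2 := by norm_cast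
    simp [hre]
    ring
  refine ⟨((2 * π) ^ ((d : ℝ) / 2))⁻¹, by positivity, ?_⟩
  set c : ℝ := ((2 * π) ^ ((d : ℝ) / 2))⁻¹ with hc
  have hc0 : 0 < c := by positivity
  have hfin : IsFiniteMeasure
      (volume.withDensity fun z : Vec d => ENNReal.ofReal (c * Real.exp (-‖z‖ ^ 2 / 2))) :=
    isFiniteMeasure_withDensity_ofReal (hI.const_mul c).2
  have hmap : _root_.stdGaussian d = ProbabilityTheory.stdGaussian (Vec d) := by
    rw [← map_pi_eq_stdGaussian]
    rfl
  rw [hmap]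
  apply Measure.ext_of_charFun
  ext s
  rw [charFun_stdGaussian, charFun_apply,
    integral_withDensity_eq_integral_toReal_smul (by fun_prop) (by simp)]
  have h := GaussianFourier.integral_cexp_neg_mul_sq_norm_add (V := Vec d)
    (b := 1 / 2) (by norm_num) Complex.I s
  have hcong : ∀ z : Vec d, (ENNReal.ofReal (c * Real.exp (-‖z‖ ^ 2 / 2))).toReal •
      Complex.exp (⟪z, s⟫ * Complex.I) =
      (c : ℂ) * Complex.exp (-(1 / 2) * ‖z‖ ^ 2 + Complex.I * ⟪s, z⟫) := by
    intro z
    rw [ENNReal.toReal_ofReal (by positivity), Complex.real_smul, Complex.ofReal_mul, mul_assoc,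
      Complex.ofReal_exp, ← Complex.exp_add, real_inner_comm]
    congr 2
    push_cast
    ring
  simp_rw [hcong]
  rw [integral_const_mul, h]
  have hpow : ((π : ℂ) / (1 / 2)) ^ ((Module.finrank ℝ (Vec d) : ℂ) / 2) =
      (((2 * π) ^ ((d : ℝ) / 2) : ℝ) : ℂ) := by
    rw [Complex.ofReal_cpow (by positivity), finrank_euclideanSpace_fin]
    push_cast
    congr 1
    ring
  rw [hpow, ← mul_assoc, ← Complex.ofReal_mul, hc, inv_mul_cancel₀ (by positivity)]
  simp
  ring_nf

lemma lintegral_add_smul_eq {d : ℕ} (v : Vec d) {r : ℝ} (hr : r ≠ 0)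
    {h : Vec d → ENNReal} (hh : Measurable h) :
    ∫⁻ z, h (v + r • z) = ENNReal.ofReal |(r ^ d)⁻¹| * ∫⁻ y, h y := by
  have hm := Measure.map_addHaar_smul (volume : Measure (Vec d)) hr
  rw [finrank_euclideanSpace_fin] at hm
  rw [← lintegral_map (f := fun y => h (v + y)) (by fun_prop) (measurable_const_smul r), hm,
    lintegral_smul_measure, lintegral_add_left_eq_self, smul_eq_mul]

lemma one_sub_exp_pos {t : ℝ} (ht : 0 < t) : 0 < 1 - Real.exp (-2 * t) := by
  have : Real.exp (-2 * t) < 1 := Real.exp_lt_one_iff.2 (by linarith)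
  linarith

@[fun_prop]
lemma Measurable.weight {α : Type*} [MeasurableSpace α] {d : ℕ} (t : ℝ) {f g : α → Vec d}
    (hf : Measurable f) (hg : Measurable g) : Measurable fun a => weight t (f a) (g a) := by
  unfold _root_.weight
  fun_prop

lemma weight_pos {d : ℕ} (t : ℝ) (x θ : Vec d) : 0 < weight t x θ := Real.exp_pos _

lemma integrable_weight {d : ℕ} (q0 : Measure (Vec d)) [IsFiniteMeasure q0] {t : ℝ} (ht : 0 < t)
    (x : Vec d) : Integrable (fun θ => weight t x θ) q0 := by
  refine Integrable.of_bound (C := 1)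
    (by fun_prop : Measurable _).aestronglyMeasurable
    (Filter.Eventually.of_forall fun θ => ?_)
  rw [Real.norm_of_nonneg (weight_pos _ _ _).le]
  refine Real.exp_le_one_iff.2 (div_nonpos_of_nonpos_of_nonneg (by simp) ?_)
  linarith [one_sub_exp_pos ht]

/-- `q_t` has density proportional to the partition function `Z_{t,x}`. -/
lemma forwardLaw_eq_withDensity {d : ℕ} (q0 : Measure (Vec d)) [IsProbabilityMeasure q0] {t : ℝ}
    (ht : 0 < t) :
    ∃ C : ℝ, 0 < C ∧ forwardLaw q0 t =
      volume.withDensity fun x => ENNReal.ofReal (C * ∫ θ, weight t x θ ∂q0) := by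
  obtain ⟨c, hc, hg⟩ := stdGaussian_eq_withDensity d
  have hs := one_sub_exp_pos ht
  set σ := Real.sqrt (1 - Real.exp (-2 * t)) with hσ
  have hσ0 : 0 < σ := Real.sqrt_pos.2 hs
  have hσ2 : σ ^ 2 = 1 - Real.exp (-2 * t) := Real.sq_sqrt hs.le
  refine ⟨c * |(σ ^ d)⁻¹|, by positivity, ?_⟩
  have hsf : SFinite (_root_.stdGaussian d) := by
    rw [hg]; infer_instance
  ext s hms
  have hcond : ∀ θ : Vec d, _root_.stdGaussian d
      (Prod.mk θ ⁻¹' ((fun p : Vec d × Vec d => Real.exp (-t) • p.1 + σ • p.2) ⁻¹' s)) =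
      ∫⁻ y in s, ENNReal.ofReal (c * |(σ ^ d)⁻¹|) * ENNReal.ofReal (weight t y θ) := by
    intro θ
    have hms' : MeasurableSet
        (Prod.mk θ ⁻¹' ((fun p : Vec d × Vec d => Real.exp (-t) • p.1 + σ • p.2) ⁻¹' s)) :=
      (by fun_prop : Measurable fun z : Vec d => Real.exp (-t) • θ + σ • z) hms
    rw [hg, withDensity_apply _ hms', ← lintegral_indicator hms', ← lintegral_indicator hms]
    have hw1 : Measurable fun y => ENNReal.ofReal (weight t y θ) := by
      fun_prop
    have hcv := lintegral_add_smul_eq (Real.exp (-t) • θ) hσ0.ne'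
      (h := s.indicator fun y => ENNReal.ofReal c * ENNReal.ofReal (weight t y θ))
      ((hw1.const_mul _).indicator hms)
    rw [← lintegral_const_mul _ ((hw1.const_mul _).indicator hms)] at hcv
    refine Eq.trans (lintegral_congr fun z => ?_) (hcv.trans (lintegral_congr fun y => ?_))
    · by_cases hz : Real.exp (-t) • θ + σ • z ∈ s
      · rw [Set.indicator_of_mem (by exact hz), Set.indicator_of_mem hz,
          ← ENNReal.ofReal_mul hc.le]
        congr 2
        unfold weight
        rw [add_sub_cancel_left, norm_smul, mul_pow, Real.norm_of_nonneg hσ0.le, ← hσ2]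
        congr 1
        field_simp
      · rw [Set.indicator_of_notMem (by exact hz), Set.indicator_of_notMem hz]
    · by_cases hy : y ∈ s
      · rw [Set.indicator_of_mem hy, Set.indicator_of_mem hy, ENNReal.ofReal_mul hc.le]
        ring
      · rw [Set.indicator_of_notMem hy, Set.indicator_of_notMem hy, mul_zero]
  rw [forwardLaw, Measure.map_apply (by fun_prop) hms,
    Measure.prod_apply ((by fun_prop : Measurable fun p : Vec d × Vec d =>
      Real.exp (-t) • p.1 + Real.sqrt (1 - Real.exp (-2 * t)) • p.2) hms), withDensity_apply _ hms]
  simp_rw [← hσ, hcond]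
  rw [lintegral_lintegral_swap (by fun_prop)]
  refine lintegral_congr fun y => ?_
  rw [lintegral_const_mul _ (by fun_prop),
    ENNReal.ofReal_mul (p := c * |(σ ^ d)⁻¹|) (by positivity), ofReal_integral_eq_lintegral_ofReal
      (integrable_weight q0 ht y) (Filter.Eventually.of_forall fun θ => (weight_pos _ _ _).le)]

/-- The exponential tilt `exp(a⟪x, θ⟫ - c‖θ‖²)`, which is the part of the Gaussian weight that
depends on `θ`. -/
def tilt {d : ℕ} (a c : ℝ) (x θ : Vec d) : ℝ := Real.exp (a * ⟪x, θ⟫ - c * ‖θ‖ ^ 2)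

/-- The tilted integral `∫ f(θ) exp(a⟪x, θ⟫ - c‖θ‖²) dq0(θ)`. -/
def tiltIntegral {d : ℕ} (q0 : Measure (Vec d)) (a c : ℝ) (f : Vec d → ℝ) (x : Vec d) : ℝ :=
  ∫ θ, f θ * tilt a c x θ ∂q0

/-- The expectation of `f` under the normalized tilt of `q0`. -/
def tiltMean {d : ℕ} (q0 : Measure (Vec d)) (a c : ℝ) (f : Vec d → ℝ) (x : Vec d) : ℝ :=
  tiltIntegral q0 a c f x / tiltIntegral q0 a c (fun _ => 1) x

/-- `f` is integrable against `exp(b‖θ‖ - c‖θ‖²) dq0(θ)` for all `b`. -/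
structure TiltIntegrable {d : ℕ} (q0 : Measure (Vec d)) (c : ℝ) (f : Vec d → ℝ) : Prop where
  aestronglyMeasurable : AEStronglyMeasurable f q0
  integrable : ∀ b : ℝ, Integrable (fun θ => f θ * Real.exp (b * ‖θ‖ - c * ‖θ‖ ^ 2)) q0

section Tilt

variable {d : ℕ} {q0 : Measure (Vec d)} {a c : ℝ} {f : Vec d → ℝ}

lemma tilt_pos (a c : ℝ) (x θ : Vec d) : 0 < tilt a c x θ := Real.exp_pos _

@[fun_prop]
lemma continuous_tilt (a c : ℝ) (x : Vec d) : Continuous (tilt a c x) := by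
  unfold tilt
  fun_prop

lemma tilt_le (a c : ℝ) {x : Vec d} {r : ℝ} (hx : ‖x‖ ≤ r) (θ : Vec d) :
    tilt a c x θ ≤ Real.exp (|a| * r * ‖θ‖ - c * ‖θ‖ ^ 2) := by
  refine Real.exp_le_exp.2 (sub_le_sub_right ?_ _)
  calc a * ⟪x, θ⟫ ≤ |a| * |⟪x, θ⟫| := by rw [← abs_mul]; exact le_abs_self _
    _ ≤ |a| * (‖x‖ * ‖θ‖) := by gcongr; exact abs_real_inner_le_norm x θ
    _ ≤ |a| * r * ‖θ‖ := by rw [mul_assoc]; gcongr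

lemma tiltIntegrable_one [IsFiniteMeasure q0] (hc : 0 < c) :
    TiltIntegrable q0 c fun _ => 1 := by
  refine ⟨by fun_prop, fun b => ?_⟩
  refine Integrable.of_bound (C := Real.exp (b ^ 2 / (4 * c)))
    (by fun_prop) (Filter.Eventually.of_forall fun θ => ?_)
  rw [one_mul, Real.norm_of_nonneg (Real.exp_pos _).le]
  refine Real.exp_le_exp.2 ?_
  rw [le_div_iff₀ (by positivity)]
  nlinarith [sq_nonneg (b - 2 * c * ‖θ‖)]

lemma TiltIntegrable.mul_norm (hf : TiltIntegrable q0 c f) :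
    TiltIntegrable q0 c fun θ => f θ * ‖θ‖ := by
  refine ⟨hf.1.mul (by fun_prop), fun b => ?_⟩
  refine (hf.integrable (b + 1)).norm.mono'
    ((hf.1.mul (by fun_prop)).mul (by fun_prop)) (Filter.Eventually.of_forall fun θ => ?_)
  have h1 : ‖θ‖ ≤ Real.exp ‖θ‖ := by linarith [Real.add_one_le_exp ‖θ‖]
  rw [show (b + 1) * ‖θ‖ - c * ‖θ‖ ^ 2 = ‖θ‖ + (b * ‖θ‖ - c * ‖θ‖ ^ 2) by ring, Real.exp_add,
    ← mul_assoc]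
  simp only [norm_mul, norm_norm, Real.norm_of_nonneg (Real.exp_pos _).le]
  gcongr

lemma TiltIntegrable.mul_coord (hf : TiltIntegrable q0 c f) (i : Fin d) :
    TiltIntegrable q0 c fun θ => f θ * θ i := by
  refine ⟨hf.1.mul (by fun_prop), fun b => ?_⟩
  refine (hf.mul_norm.integrable b).norm.mono'
    ((hf.1.mul (by fun_prop)).mul (by fun_prop)) (Filter.Eventually.of_forall fun θ => ?_)
  simp only [norm_mul, norm_norm]
  gcongr
  exact PiLp.norm_apply_le θ i

lemma tiltIntegrable_coord [IsFiniteMeasure q0] (hc : 0 < c) (i : Fin d) :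
    TiltIntegrable q0 c fun θ => θ i := by
  simpa using (tiltIntegrable_one (q0 := q0) hc).mul_coord i

lemma TiltIntegrable.integrable_mul_tilt (hf : TiltIntegrable q0 c f) (a : ℝ) (x : Vec d) :
    Integrable (fun θ => f θ * tilt a c x θ) q0 := by
  refine (hf.integrable (|a| * ‖x‖)).norm.mono' (hf.1.mul (by fun_prop))
    (Filter.Eventually.of_forall fun θ => ?_)
  simp only [norm_mul, Real.norm_of_nonneg (Real.exp_pos _).le,
    Real.norm_of_nonneg (tilt_pos _ _ _ _).le]
  gcongr
  exact tilt_le a c le_rfl θ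

lemma hasFDerivAt_tilt (a c : ℝ) (x θ : Vec d) :
    HasFDerivAt (fun y => tilt a c y θ) ((tilt a c x θ * a) • innerSL ℝ θ) x := by
  have h : HasFDerivAt (fun y : Vec d => a * ⟪y, θ⟫ - c * ‖θ‖ ^ 2) (a • innerSL ℝ θ) x := by
    have h0 : HasFDerivAt (fun y : Vec d => ⟪θ, y⟫) (innerSL ℝ θ) x :=
      (innerSL ℝ θ).hasFDerivAt
    simp_rw [real_inner_comm θ]
    exact (h0.const_mul a).sub_const _
  have h2 := h.exp
  rwa [smul_smul] at h2

lemma TiltIntegrable.hasFDerivAt_tiltIntegral (hf : TiltIntegrable q0 c f) (a : ℝ) (x : Vec d) :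
    HasFDerivAt (tiltIntegral q0 a c f)
      (∫ θ, (f θ * (tilt a c x θ * a)) • innerSL ℝ θ ∂q0) x := by
  have hbound := (hf.mul_norm.integrable (|a| * (‖x‖ + 1))).norm.const_mul |a|
  refine hasFDerivAt_integral_of_dominated_of_fderiv_le
    (F' := fun y θ => (f θ * (tilt a c y θ * a)) • innerSL ℝ θ)
    (Metric.ball_mem_nhds x one_pos)
    (Filter.Eventually.of_forall fun y => (hf.integrable_mul_tilt a y).1)
    (hf.integrable_mul_tilt a x) ?_ (Filter.Eventually.of_forall fun θ y hy => ?_) hbound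
    (Filter.Eventually.of_forall fun θ y _ => ?_)
  · exact (hf.1.mul (by fun_prop)).smul (by fun_prop)
  · have hy' : ‖y‖ ≤ ‖x‖ + 1 := by
      have := norm_le_norm_add_norm_sub' y x
      rw [Metric.mem_ball, dist_eq_norm] at hy
      linarith
    have ht := tilt_le a c hy' θ
    simp only [norm_smul, norm_mul, innerSL_apply_norm, norm_norm,
      Real.norm_of_nonneg (Real.exp_pos _).le, Real.norm_of_nonneg (tilt_pos _ _ _ _).le,
      Real.norm_eq_abs a]
    calc ‖f θ‖ * (tilt a c y θ * |a|) * ‖θ‖ = |a| * (‖f θ‖ * ‖θ‖ * tilt a c y θ) := by ring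
      _ ≤ _ := by gcongr
  · have h := (hasFDerivAt_tilt a c y θ).const_mul (f θ)
    rwa [smul_smul] at h

lemma TiltIntegrable.differentiable_tiltIntegral (hf : TiltIntegrable q0 c f) (a : ℝ) :
    Differentiable ℝ (tiltIntegral q0 a c f) :=
  fun x => (hf.hasFDerivAt_tiltIntegral a x).differentiableAt

lemma TiltIntegrable.pd_tiltIntegral (hf : TiltIntegrable q0 c f) (a : ℝ) (i : Fin d)
    (x : Vec d) :
    pd i (tiltIntegral q0 a c f) x = a * tiltIntegral q0 a c (fun θ => f θ * θ i) x := by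
  have hint : Integrable (fun θ => (f θ * (tilt a c x θ * a)) • innerSL ℝ θ) q0 := by
    refine ((hf.mul_norm.integrable_mul_tilt a x).const_mul |a|).norm.mono'
      ((hf.1.mul (by fun_prop)).smul (by fun_prop)) (Filter.Eventually.of_forall fun θ => ?_)
    simp only [norm_smul, norm_mul, innerSL_apply_norm, norm_norm, Real.norm_eq_abs a,
      Real.norm_eq_abs |a|, abs_abs]
    exact le_of_eq (by ring)
  rw [pd, (hf.hasFDerivAt_tiltIntegral a x).fderiv,
    ContinuousLinearMap.integral_apply hint, tiltIntegral, ← integral_const_mul]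
  refine integral_congr_ae (Filter.Eventually.of_forall fun θ => ?_)
  simp [EuclideanSpace.inner_single_right]
  ring

lemma tiltIntegral_one_pos [IsProbabilityMeasure q0] (hc : 0 < c) (a : ℝ) (x : Vec d) :
    0 < tiltIntegral q0 a c (fun _ => 1) x := by
  rw [tiltIntegral, integral_pos_iff_support_of_nonneg
    (fun θ => by simpa using (tilt_pos a c x θ).le)
    ((tiltIntegrable_one hc).integrable_mul_tilt a x)]
  have : (Function.support fun θ : Vec d => 1 * tilt a c x θ) = Set.univ := by
    ext θ
    simp [(tilt_pos a c x θ).ne']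
  rw [this, measure_univ]
  exact one_pos

lemma TiltIntegrable.differentiable_tiltMean [IsProbabilityMeasure q0] (hc : 0 < c)
    (hf : TiltIntegrable q0 c f) (a : ℝ) : Differentiable ℝ (tiltMean q0 a c f) :=
  fun x => (hf.differentiable_tiltIntegral a x).fun_mul
    (((tiltIntegrable_one hc).differentiable_tiltIntegral a x).inv
      (tiltIntegral_one_pos hc a x).ne')

lemma TiltIntegrable.pd_tiltMean [IsProbabilityMeasure q0] (hc : 0 < c)
    (hf : TiltIntegrable q0 c f) (a : ℝ) (i : Fin d) (x : Vec d) :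
    pd i (tiltMean q0 a c f) x = a * (tiltMean q0 a c (fun θ => f θ * θ i) x -
      tiltMean q0 a c f x * tiltMean q0 a c (fun θ => θ i) x) := by
  have h1 := (tiltIntegrable_one (q0 := q0) hc)
  have hpos := (tiltIntegral_one_pos (q0 := q0) hc a x).ne'
  have hd : pd i (tiltMean q0 a c f) x =
      (pd i (tiltIntegral q0 a c f) x * tiltIntegral q0 a c (fun _ => 1) x -
        tiltIntegral q0 a c f x * pd i (tiltIntegral q0 a c fun _ => 1) x) /
        tiltIntegral q0 a c (fun _ => 1) x ^ 2 := by
    have hinv : HasFDerivAt (fun y => (tiltIntegral q0 a c (fun _ => 1) y)⁻¹) _ x :=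
      (hasDerivAt_inv hpos).comp_hasFDerivAt x (h1.differentiable_tiltIntegral a x).hasFDerivAt
    unfold pd tiltMean
    simp_rw [div_eq_mul_inv]
    rw [fderiv_fun_mul (hf.differentiable_tiltIntegral a x)
      hinv.differentiableAt, hinv.fderiv]
    simp
    field_simp
    ring
  rw [hd, hf.pd_tiltIntegral, h1.pd_tiltIntegral]
  simp only [one_mul, tiltMean]
  field_simp

lemma pd_log_tiltIntegral_one [IsProbabilityMeasure q0] (hc : 0 < c) (a : ℝ) (i : Fin d)
    (x : Vec d) :
    pd i (fun y => Real.log (tiltIntegral q0 a c (fun _ => 1) y)) x =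
      a * tiltMean q0 a c (fun θ => θ i) x := by
  have h1 := (tiltIntegrable_one (q0 := q0) hc)
  have h := ((h1.differentiable_tiltIntegral a x).hasFDerivAt.log
    (tiltIntegral_one_pos (q0 := q0) hc a x).ne').fderiv
  have h2 := h1.pd_tiltIntegral a i x
  rw [pd] at h2 ⊢
  rw [h]
  simp only [_root_.smul_apply, h2, one_mul, tiltMean, smul_eq_mul]
  ring

end Tilt

lemma pd_add {d : ℕ} (i : Fin d) {f g : Vec d → ℝ} {x : Vec d} (hf : DifferentiableAt ℝ f x)
    (hg : DifferentiableAt ℝ g x) : pd i (fun y => f y + g y) x = pd i f x + pd i g x := by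
  rw [pd, fderiv_fun_add hf hg]
  rfl

lemma pd_const_mul {d : ℕ} (i : Fin d) {f : Vec d → ℝ} {x : Vec d} (hf : DifferentiableAt ℝ f x)
    (r : ℝ) : pd i (fun y => r * f y) x = r * pd i f x := by
  rw [pd, fderiv_const_mul hf]
  rfl

lemma pd_mul {d : ℕ} (i : Fin d) {f g : Vec d → ℝ} {x : Vec d} (hf : DifferentiableAt ℝ f x)
    (hg : DifferentiableAt ℝ g x) :
    pd i (fun y => f y * g y) x = pd i f x * g x + f x * pd i g x := by
  rw [pd, fderiv_fun_mul hf hg]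
  simp [pd]
  ring

lemma pd_const {d : ℕ} (i : Fin d) (r : ℝ) (x : Vec d) : pd i (fun _ => r) x = 0 := by
  simp [pd]

lemma pd_coord {d : ℕ} (i k : Fin d) (x : Vec d) :
    pd i (fun y => y k) x = EuclideanSpace.single i (1 : ℝ) k := by
  have h : HasFDerivAt (fun y : Vec d => y k) (EuclideanSpace.proj k : Vec d →L[ℝ] ℝ) x :=
    (EuclideanSpace.proj k : Vec d →L[ℝ] ℝ).hasFDerivAt
  rw [pd, h.fderiv]
  rfl

lemma pd_norm_sq {d : ℕ} (k : Fin d) (x : Vec d) : pd k (fun y => ‖y‖ ^ 2) x = 2 * x k := by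
  rw [pd, fderiv_norm_sq_apply]
  simp [EuclideanSpace.inner_single_right]

/-- The third derivatives of `r + b‖y‖² + log ∫ exp(a⟪y, θ⟫ - c‖θ‖²) dq0(θ)` are the third
cumulants of the tilted measure, up to the factor `a³`. -/
lemma pd_pd_pd_log_tiltIntegral {d : ℕ} {q0 : Measure (Vec d)} [IsProbabilityMeasure q0] {c : ℝ}
    (hc : 0 < c) (a b r : ℝ) (i j k : Fin d) (x : Vec d) :
    pd i (pd j (pd k fun y => (r + b * ‖y‖ ^ 2) +
        Real.log (tiltIntegral q0 a c (fun _ => 1) y))) x =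
      a ^ 3 * (tiltMean q0 a c (fun θ => θ i * θ j * θ k) x
        - tiltMean q0 a c (fun θ => θ i) x * tiltMean q0 a c (fun θ => θ j * θ k) x
        - tiltMean q0 a c (fun θ => θ j) x * tiltMean q0 a c (fun θ => θ i * θ k) x
        - tiltMean q0 a c (fun θ => θ k) x * tiltMean q0 a c (fun θ => θ i * θ j) x
        + 2 * tiltMean q0 a c (fun θ => θ i) x * tiltMean q0 a c (fun θ => θ j) x
          * tiltMean q0 a c (fun θ => θ k) x) := by
  have hcoord (l : Fin d) := tiltIntegrable_coord (q0 := q0) hc l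
  have hdiff (l : Fin d) := (hcoord l).differentiable_tiltMean hc a
  have hsq (y : Vec d) : DifferentiableAt ℝ (fun y : Vec d => ‖y‖ ^ 2) y :=
    (contDiff_norm_sq ℝ (n := 1)).differentiable one_ne_zero y
  have hjk := ((hcoord k).mul_coord j).differentiable_tiltMean hc a
  have h1 : pd k (fun y => (r + b * ‖y‖ ^ 2) + Real.log (tiltIntegral q0 a c (fun _ => 1) y)) =
      fun y => 2 * b * y k + a * tiltMean q0 a c (fun θ => θ k) y := by
    funext y
    rw [pd_add k ((differentiableAt_const _).fun_add ((hsq y).const_mul b))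
      (((tiltIntegrable_one hc).differentiable_tiltIntegral a y).log
        (tiltIntegral_one_pos hc a y).ne'), pd_add k (differentiableAt_const _)
        ((hsq y).const_mul b), pd_const, pd_const_mul k (hsq y), pd_norm_sq,
      pd_log_tiltIntegral_one hc]
    ring
  have h2 : pd j (fun y => 2 * b * y k + a * tiltMean q0 a c (fun θ => θ k) y) =
      fun y => 2 * b * EuclideanSpace.single j (1 : ℝ) k + a ^ 2 *
        (tiltMean q0 a c (fun θ => θ k * θ j) y + (-1) * (tiltMean q0 a c (fun θ => θ k) y *
          tiltMean q0 a c (fun θ => θ j) y)) := by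
    funext y
    have hk : DifferentiableAt ℝ (fun y : Vec d => y k) y := by fun_prop
    rw [pd_add j (hk.const_mul _) ((hdiff k y).const_mul a), pd_const_mul j hk, pd_coord,
      pd_const_mul j (hdiff k y), (hcoord k).pd_tiltMean hc]
    ring
  have hprod := (hdiff k x).fun_mul (hdiff j x)
  rw [h1, h2, pd_add i (differentiableAt_const _)
      (((hjk x).fun_add (hprod.const_mul _)).const_mul _), pd_const,
    pd_const_mul i ((hjk x).fun_add (hprod.const_mul _)), pd_add i (hjk x) (hprod.const_mul _),
    pd_const_mul i hprod, pd_mul i (hdiff k x) (hdiff j x),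
    ((hcoord k).mul_coord j).pd_tiltMean hc, (hcoord k).pd_tiltMean hc, (hcoord j).pd_tiltMean hc]
  have e1 : (fun θ : Vec d => θ k * θ j * θ i) = fun θ => θ i * θ j * θ k := by
    funext θ; ring
  have e2 : (fun θ : Vec d => θ k * θ j) = fun θ => θ j * θ k := by funext θ; ring
  have e3 : (fun θ : Vec d => θ k * θ i) = fun θ => θ i * θ k := by funext θ; ring
  have e4 : (fun θ : Vec d => θ j * θ i) = fun θ => θ i * θ j := by funext θ; ring
  rw [e1, e2, e3, e4]
  ring

lemma integral_sub_mul_sub_mul_sub {Ω : Type*} [MeasurableSpace Ω] {μ : Measure Ω}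
    [IsProbabilityMeasure μ] {X Y Z : Ω → ℝ} (hX : Integrable X μ) (hY : Integrable Y μ)
    (hZ : Integrable Z μ) (hXY : Integrable (fun ω => X ω * Y ω) μ)
    (hXZ : Integrable (fun ω => X ω * Z ω) μ) (hYZ : Integrable (fun ω => Y ω * Z ω) μ)
    (hXYZ : Integrable (fun ω => X ω * Y ω * Z ω) μ) (x y z : ℝ) :
    ∫ ω, (X ω - x) * (Y ω - y) * (Z ω - z) ∂μ =
      ∫ ω, X ω * Y ω * Z ω ∂μ - z * ∫ ω, X ω * Y ω ∂μ - y * ∫ ω, X ω * Z ω ∂μ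
        - x * ∫ ω, Y ω * Z ω ∂μ + y * z * ∫ ω, X ω ∂μ + x * z * ∫ ω, Y ω ∂μ
        + x * y * ∫ ω, Z ω ∂μ - x * y * z := by
  have h1 := hXYZ.sub' (hXY.const_mul z)
  have h2 := h1.sub' (hXZ.const_mul y)
  have h3 := h2.sub' (hYZ.const_mul x)
  have h4 := h3.fun_add (hX.const_mul (y * z))
  have h5 := h4.fun_add (hY.const_mul (x * z))
  have h6 := h5.fun_add (hZ.const_mul (x * y))
  have e : ∀ ω, (X ω - x) * (Y ω - y) * (Z ω - z) =
      X ω * Y ω * Z ω - z * (X ω * Y ω) - y * (X ω * Z ω) - x * (Y ω * Z ω)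
        + y * z * X ω + x * z * Y ω + x * y * Z ω - x * y * z := fun ω => by ring
  simp_rw [e]
  rw [integral_sub h6 (integrable_const _), integral_add h5 (hZ.const_mul _),
    integral_add h4 (hY.const_mul _), integral_add h3 (hX.const_mul _),
    integral_sub h2 (hYZ.const_mul _), integral_sub h1 (hXZ.const_mul _),
    integral_sub hXYZ (hXY.const_mul _)]
  simp [integral_const_mul]

lemma weight_eq_mul_tilt {d : ℕ} {t : ℝ} (ht : 0 < t) (x θ : Vec d) :
    weight t x θ = Real.exp (-1 / (2 * (1 - Real.exp (-2 * t))) * ‖x‖ ^ 2) *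
      tilt (Real.exp (-t) / (1 - Real.exp (-2 * t)))
        (Real.exp (-t) ^ 2 / (2 * (1 - Real.exp (-2 * t)))) x θ := by
  have hs := (one_sub_exp_pos ht).ne'
  rw [weight, tilt, ← Real.exp_add, norm_sub_sq_real, real_inner_smul_right, norm_smul,
    Real.norm_of_nonneg (Real.exp_pos _).le]
  congr 1
  field_simp
  ring

lemma lintegral_weight_eq {d : ℕ} (q0 : Measure (Vec d)) [IsProbabilityMeasure q0] {t : ℝ}
    (ht : 0 < t) (x : Vec d) :
    ∫⁻ θ, ENNReal.ofReal (weight t x θ) ∂q0 = ENNReal.ofReal (∫ θ, weight t x θ ∂q0) :=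
  (ofReal_integral_eq_lintegral_ofReal (integrable_weight q0 ht x)
    (Filter.Eventually.of_forall fun _ => (weight_pos _ _ _).le)).symm

lemma integral_weight_eq {d : ℕ} (q0 : Measure (Vec d)) {t : ℝ} (ht : 0 < t) (x : Vec d) :
    ∫ θ, weight t x θ ∂q0 = Real.exp (-1 / (2 * (1 - Real.exp (-2 * t))) * ‖x‖ ^ 2) *
      tiltIntegral q0 (Real.exp (-t) / (1 - Real.exp (-2 * t)))
        (Real.exp (-t) ^ 2 / (2 * (1 - Real.exp (-2 * t)))) (fun _ => 1) x := by
  simp_rw [weight_eq_mul_tilt ht, tiltIntegral, one_mul, integral_const_mul]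

lemma integral_condMeasure {d : ℕ} (q0 : Measure (Vec d)) [IsProbabilityMeasure q0] {t : ℝ}
    (ht : 0 < t) (x : Vec d) (f : Vec d → ℝ) :
    ∫ θ, f θ ∂(condMeasure q0 t x) =
      tiltMean q0 (Real.exp (-t) / (1 - Real.exp (-2 * t)))
        (Real.exp (-t) ^ 2 / (2 * (1 - Real.exp (-2 * t)))) f x := by
  have hs := one_sub_exp_pos ht
  have hpos := tiltIntegral_one_pos (q0 := q0)
    (c := Real.exp (-t) ^ 2 / (2 * (1 - Real.exp (-2 * t)))) (by positivity)
    (Real.exp (-t) / (1 - Real.exp (-2 * t))) x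
  rw [condMeasure, integral_smul_measure, lintegral_weight_eq q0 ht,
    integral_withDensity_eq_integral_toReal_smul (by fun_prop) (by simp), tiltMean,
    integral_weight_eq q0 ht, ENNReal.toReal_inv, ENNReal.toReal_ofReal (by positivity)]
  simp_rw [ENNReal.toReal_ofReal (weight_pos _ _ _).le, weight_eq_mul_tilt ht, smul_eq_mul,
    mul_assoc, integral_const_mul]
  have hcomm : ∫ θ, tilt (Real.exp (-t) / (1 - Real.exp (-2 * t)))
      (Real.exp (-t) ^ 2 / (2 * (1 - Real.exp (-2 * t)))) x θ * f θ ∂q0 =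
      tiltIntegral q0 (Real.exp (-t) / (1 - Real.exp (-2 * t)))
        (Real.exp (-t) ^ 2 / (2 * (1 - Real.exp (-2 * t)))) f x :=
    integral_congr_ae (Filter.Eventually.of_forall fun θ => mul_comm _ _)
  rw [hcomm]
  field_simp

lemma isProbabilityMeasure_condMeasure {d : ℕ} (q0 : Measure (Vec d)) [IsProbabilityMeasure q0]
    {t : ℝ} (ht : 0 < t) (x : Vec d) : IsProbabilityMeasure (condMeasure q0 t x) := by
  have hs := one_sub_exp_pos ht
  have hpos := tiltIntegral_one_pos (q0 := q0)
    (c := Real.exp (-t) ^ 2 / (2 * (1 - Real.exp (-2 * t)))) (by positivity)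
    (Real.exp (-t) / (1 - Real.exp (-2 * t))) x
  refine ⟨?_⟩
  rw [condMeasure, Measure.smul_apply, withDensity_apply _ MeasurableSet.univ,
    setLIntegral_univ, smul_eq_mul, lintegral_weight_eq q0 ht, integral_weight_eq q0 ht]
  exact ENNReal.inv_mul_cancel (by simp only [ne_eq, ENNReal.ofReal_eq_zero, not_le]; positivity)
    (by simp)

lemma TiltIntegrable.integrable_condMeasure {d : ℕ} {q0 : Measure (Vec d)}
    [IsProbabilityMeasure q0] {t : ℝ} (ht : 0 < t) (x : Vec d) {f : Vec d → ℝ}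
    (hf : TiltIntegrable q0 (Real.exp (-t) ^ 2 / (2 * (1 - Real.exp (-2 * t)))) f) :
    Integrable f (condMeasure q0 t x) := by
  have hs := one_sub_exp_pos ht
  have hpos := tiltIntegral_one_pos (q0 := q0)
    (c := Real.exp (-t) ^ 2 / (2 * (1 - Real.exp (-2 * t)))) (by positivity)
    (Real.exp (-t) / (1 - Real.exp (-2 * t))) x
  refine Integrable.smul_measure ?_ ?_
  · rw [integrable_withDensity_iff_integrable_smul' (by fun_prop) (by simp)]
    simp_rw [ENNReal.toReal_ofReal (weight_pos _ _ _).le, weight_eq_mul_tilt ht, smul_eq_mul,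
      mul_assoc, mul_comm (tilt _ _ _ _)]
    exact (hf.integrable_mul_tilt _ x).const_mul _
  · rw [lintegral_weight_eq q0 ht, integral_weight_eq q0 ht]
    simp only [ne_eq, ENNReal.inv_eq_top, ENNReal.ofReal_eq_zero, not_le]
    positivity

lemma condMean_apply {d : ℕ} (q0 : Measure (Vec d)) [IsProbabilityMeasure q0] {t : ℝ}
    (ht : 0 < t) (x : Vec d) (i : Fin d) :
    condMean q0 t x i = ∫ θ, θ i ∂(condMeasure q0 t x) := by
  have hs := one_sub_exp_pos ht
  refine eval_integral_piLp (f := fun θ : Vec d => θ) (fun l => ?_) i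
  exact (tiltIntegrable_coord (by positivity) l).integrable_condMeasure ht x

/-- A continuous density of `q_t` is a constant multiple of the partition function. -/
lemma exists_density_eq {d : ℕ} (q0 : Measure (Vec d)) [IsProbabilityMeasure q0] {t : ℝ}
    (ht : 0 < t) {p : Vec d → ℝ} (hp : Continuous p) (hpos : ∀ x, 0 < p x)
    (hlaw : forwardLaw q0 t = volume.withDensity fun x => ENNReal.ofReal (p x)) :
    ∃ C : ℝ, 0 < C ∧ ∀ x, p x = C * ∫ θ, weight t x θ ∂q0 := by
  obtain ⟨C, hC, hq⟩ := forwardLaw_eq_withDensity q0 ht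
  have hs := one_sub_exp_pos ht
  have hone := tiltIntegrable_one (q0 := q0)
    (c := Real.exp (-t) ^ 2 / (2 * (1 - Real.exp (-2 * t)))) (by positivity)
  have hcont : Continuous fun x => C * ∫ θ, weight t x θ ∂q0 := by
    simp_rw [integral_weight_eq q0 ht]
    have := (hone.differentiable_tiltIntegral
      (Real.exp (-t) / (1 - Real.exp (-2 * t)))).continuous
    fun_prop
  refine ⟨C, hC, fun x => ?_⟩
  have hae := (withDensity_eq_iff_of_sigmaFinite (μ := (volume : Measure (Vec d)))
    hp.measurable.ennreal_ofReal.aemeasurable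
    hcont.measurable.ennreal_ofReal.aemeasurable).1 (hlaw.symm.trans hq)
  have heq := congrFun ((Continuous.ae_eq_iff_eq volume (ENNReal.continuous_ofReal.comp hp)
    (ENNReal.continuous_ofReal.comp hcont)).1 hae) x
  refine (ENNReal.ofReal_eq_ofReal_iff (hpos x).le ?_).1 heq
  exact mul_nonneg hC.le (integral_nonneg fun θ => (weight_pos _ _ _).le)

/-- **Lemma (third derivative of the log-density).** If `q0` has finite fourth moment then for
`t > 0` and `x ∈ ℝ^d`,
`∇_x³ log q_t(x) = λ_t³ σ_t^{-6} E_{t,x}[(θ - m)⊗(θ - m)⊗(θ - m)]`, entrywise. -/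
theorem third_deriv_log_density
    {d : ℕ} (hd : 1 ≤ d) (q0 : Measure (Vec d)) [IsProbabilityMeasure q0]
    (ρ : ℝ → Vec d → ℝ)
    (hρ : ∀ u, 0 < u → forwardLaw q0 u = volume.withDensity fun x => ENNReal.ofReal (ρ u x))
    (hρpos : ∀ u, 0 < u → ∀ x, 0 < ρ u x)
    (hρsmooth : ∀ u, 0 < u → ContDiff ℝ (⊤ : ℕ∞) (ρ u))
    (hmom : Integrable (fun θ => ‖θ‖^4) q0)
    (t : ℝ) (ht : 0 < t) (x : Vec d) (i j k : Fin d) :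
    pd i (pd j (pd k (fun y => Real.log (ρ t y)))) x
      = Real.exp (-t)^3 / (1 - Real.exp (-2*t))^3
        * ∫ θ, (θ i - condMean q0 t x i) * (θ j - condMean q0 t x j)
            * (θ k - condMean q0 t x k) ∂(condMeasure q0 t x) := by
  have hs := one_sub_exp_pos ht
  have hprob := isProbabilityMeasure_condMeasure q0 ht x
  obtain ⟨C, hC, hdens⟩ := exists_density_eq q0 ht (hρsmooth t ht).continuous (hρpos t ht) (hρ t ht)
  set a := Real.exp (-t) / (1 - Real.exp (-2 * t)) with ha
  set c := Real.exp (-t) ^ 2 / (2 * (1 - Real.exp (-2 * t))) with hc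
  have hc0 : 0 < c := by positivity
  have hlog : (fun y => Real.log (ρ t y)) = fun y =>
      (Real.log C + -1 / (2 * (1 - Real.exp (-2 * t))) * ‖y‖ ^ 2) +
        Real.log (tiltIntegral q0 a c (fun _ => 1) y) := by
    funext y
    have hpos := tiltIntegral_one_pos (q0 := q0) hc0 a y
    rw [hdens, integral_weight_eq q0 ht, Real.log_mul hC.ne' (by positivity),
      Real.log_mul (Real.exp_pos _).ne' hpos.ne', Real.log_exp]
    ring
  have hcoord (l : Fin d) := tiltIntegrable_coord (q0 := q0) hc0 l
  have hmul (l m : Fin d) : TiltIntegrable q0 c fun θ => θ l * θ m := (hcoord l).mul_coord m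
  rw [hlog, pd_pd_pd_log_tiltIntegral hc0,
    integral_sub_mul_sub_mul_sub ((hcoord i).integrable_condMeasure ht x)
      ((hcoord j).integrable_condMeasure ht x) ((hcoord k).integrable_condMeasure ht x)
      ((hmul i j).integrable_condMeasure ht x) ((hmul i k).integrable_condMeasure ht x)
      ((hmul j k).integrable_condMeasure ht x)
      (((hmul i j).mul_coord k).integrable_condMeasure ht x)]
  simp only [condMean_apply q0 ht, integral_condMeasure q0 ht, ← ha, ← hc]
  rw [← div_pow, ← ha]
  ring

end
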